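/- There exists a constant C > 0 such that for all n with λ_n > λ, ∫₀¹ (φ_n(x) − ξ̃_n(x))² dx ≤ C/n²; consequently Σ_{n : λ_n > λ} ‖φ_n − ξ̃_n‖²_{L²(0,1)} < ∞, i.e. {ξ̃_n} is quadratically close to {φ_n} in L²(0,1). -/

import Mathlib

open MeasureTheory Real Set

/-- The Bessel function of the first kind of order `ν ≥ 0`, defined by its power series
`J_ν(x) = ∑_{m≥0} (-1)^m / (m! Γ(m+ν+1)) (x/2)^(2m+ν)`. -/
noncomputable def besselJ (ν : ℝ) (x : ℝ) : ℝ :=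
  ∑' m : ℕ, ((-1 : ℝ) ^ m / ((m.factorial : ℝ) * Real.Gamma ((m : ℝ) + ν + 1))) *
    (x / 2) ^ (2 * (m : ℝ) + ν)

/-- coefficients -/
noncomputable def bCoef (ν : ℝ) (m : ℕ) : ℝ :=
  (-1 : ℝ) ^ m / ((m.factorial : ℝ) * Real.Gamma ((m : ℝ) + ν + 1))

/-- The entire function with `J_ν(z) = (z/2)^ν g(z²/4)`. -/
noncomputable def bG (ν : ℝ) (w : ℝ) : ℝ := ∑' m : ℕ, bCoef ν m * w ^ m

theorem bGamma_lower {ν : ℝ} (hν : 0 ≤ ν) (m : ℕ) :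
    Real.Gamma (ν + 1) ≤ Real.Gamma ((m : ℝ) + ν + 1) := by
  induction m with
  | zero => simp
  | succ k ih =>
    have h0 : (0:ℝ) < (k:ℝ) + ν + 1 := by positivity
    have h1 : Real.Gamma (((k + 1 : ℕ) : ℝ) + ν + 1) = ((k:ℝ) + ν + 1) * Real.Gamma ((k:ℝ) + ν + 1) := by
      rw [← Real.Gamma_add_one h0.ne']
      push_cast
      ring_nf
    rw [h1]
    have h2 : 0 < Real.Gamma ((k:ℝ) + ν + 1) := Real.Gamma_pos_of_pos h0
    have h3 : (0:ℝ) ≤ k := Nat.cast_nonneg k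
    nlinarith

theorem bCoef_abs_le {ν : ℝ} (hν : 0 ≤ ν) (m : ℕ) :
    |bCoef ν m| ≤ (1 / Real.Gamma (ν + 1)) * (1 / (m.factorial : ℝ)) := by
  have hG : 0 < Real.Gamma (ν + 1) := Real.Gamma_pos_of_pos (by linarith)
  have hG2 := bGamma_lower hν m
  have hf : (0:ℝ) < m.factorial := by positivity
  unfold bCoef
  rw [abs_div, abs_pow, abs_neg, abs_one, one_pow, abs_of_pos (by positivity), ← one_div_mul_one_div,
    mul_comm]
  gcongr

theorem bG_summable {ν : ℝ} (hν : 0 ≤ ν) (w : ℝ) : Summable (fun m : ℕ => bCoef ν m * w ^ m) := by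
  refine Summable.of_norm_bounded
    (g := fun m : ℕ => (1 / Real.Gamma (ν + 1)) * (|w| ^ m / (m.factorial : ℝ)))
    ((Real.summable_pow_div_factorial |w|).mul_left _) ?_
  intro m
  rw [norm_mul, norm_pow, Real.norm_eq_abs, Real.norm_eq_abs]
  calc _ ≤ (1 / Real.Gamma (ν + 1)) * (1 / (m.factorial : ℝ)) * |w| ^ m := by
        gcongr; exact bCoef_abs_le hν m
    _ = _ := by ring

theorem bCoef_succ (ν : ℝ) (m : ℕ) :
    bCoef ν (m + 1) * ((m : ℝ) + 1) = - bCoef (ν + 1) m := by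
  unfold bCoef
  have hf : ((m.factorial : ℝ)) ≠ 0 := by positivity
  have hm : ((m : ℝ) + 1) ≠ 0 := by positivity
  rw [Nat.factorial_succ, show (((m + 1 : ℕ) : ℝ) + ν + 1) = (m:ℝ) + (ν + 1) + 1 by push_cast; ring]
  push_cast
  by_cases hG : Real.Gamma ((m:ℝ) + (ν + 1) + 1) = 0
  · simp [hG]
  · field_simp
    ring

theorem bG_hasDerivAt {ν : ℝ} (hν : 0 ≤ ν) (w : ℝ) :
    HasDerivAt (bG ν) (- bG (ν + 1) w) w := by
  set R : ℝ := |w| + 1 with hR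
  have hR0 : 0 < R := by positivity
  have hGp : 0 < Real.Gamma (ν + 1) := Real.Gamma_pos_of_pos (by linarith)
  have hu : Summable (fun m : ℕ => (1 / Real.Gamma (ν + 1)) * (1 / (m.factorial : ℝ)) * (m * R ^ (m - 1))) := by
    rw [← summable_nat_add_iff 1]
    refine ((Real.summable_pow_div_factorial R).mul_left (1 / Real.Gamma (ν + 1))).congr ?_
    intro m
    rw [Nat.factorial_succ]
    have hf : ((m.factorial : ℝ)) ≠ 0 := by positivity
    have hm : ((m : ℝ) + 1) ≠ 0 := by positivity
    push_cast
    field_simp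
  have key := hasDerivAt_tsum_of_isPreconnected (𝕜 := ℝ) (F := ℝ)
    (g := fun (m : ℕ) (y : ℝ) => bCoef ν m * y ^ m)
    (g' := fun (m : ℕ) (y : ℝ) => bCoef ν m * (m * y ^ (m - 1)))
    (t := Metric.ball 0 R) (y₀ := 0) (y := w) hu Metric.isOpen_ball
    (convex_ball (0:ℝ) R).isPreconnected
    (fun m y _ => (hasDerivAt_pow m y).const_mul _)
    (fun m y hy => by
      rw [Metric.mem_ball, dist_zero_right, Real.norm_eq_abs] at hy
      rw [norm_mul, norm_mul, norm_pow, Real.norm_eq_abs, Real.norm_eq_abs, Real.norm_eq_abs,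
        abs_of_nonneg (Nat.cast_nonneg (α := ℝ) m)]
      gcongr
      exact bCoef_abs_le hν m)
    (by simpa using hR0) (bG_summable hν 0)
    (by rw [Metric.mem_ball, dist_zero_right, Real.norm_eq_abs]; linarith)
  have e : (∑' m : ℕ, bCoef ν m * (m * w ^ (m - 1))) = - bG (ν + 1) w := by
    have hs : Summable (fun m : ℕ => bCoef ν (m + 1) * (((m + 1 : ℕ) : ℝ) * w ^ (m + 1 - 1))) := by
      refine (bG_summable (ν := ν + 1) (by linarith) w).neg.congr ?_
      intro m
      rw [Nat.add_sub_cancel, ← mul_assoc]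
      push_cast
      rw [bCoef_succ]; ring
    have hs' : Summable (fun m : ℕ => bCoef ν m * ((m : ℝ) * w ^ (m - 1))) :=
      (summable_nat_add_iff 1).1 hs
    rw [hs'.tsum_eq_zero_add]
    unfold bG
    rw [← tsum_neg]
    simp only [Nat.cast_zero, zero_mul, mul_zero, zero_add]
    refine tsum_congr fun m => ?_
    rw [Nat.add_sub_cancel, ← mul_assoc]
    push_cast
    rw [bCoef_succ]; ring
  rw [e] at key
  exact key

theorem bCoef_zero_rec {ν : ℝ} (hν : 0 ≤ ν) (m : ℕ) :
    bCoef ν m = ((m : ℝ) + ν + 1) * bCoef (ν + 1) m := by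
  unfold bCoef
  have h0 : (0:ℝ) < (m:ℝ) + ν + 1 := by positivity
  rw [show (m:ℝ) + (ν + 1) + 1 = ((m:ℝ) + ν + 1) + 1 by ring, Real.Gamma_add_one h0.ne']
  have := (Real.Gamma_pos_of_pos h0).ne'
  have hf : ((m.factorial : ℝ)) ≠ 0 := by positivity
  field_simp

theorem bG_rec {ν : ℝ} (hν : 0 ≤ ν) (w : ℝ) :
    w * bG (ν + 2) w = (ν + 1) * bG (ν + 1) w - bG ν w := by
  have h1 := bG_summable (ν := ν + 1) (by linarith) w
  have h0 := bG_summable hν w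
  have h2 := bG_summable (ν := ν + 2) (by linarith) w
  unfold bG
  rw [← tsum_mul_left, ← tsum_mul_left, ← (h1.mul_left _).tsum_sub h0,
    ((h1.mul_left _).sub h0).tsum_eq_zero_add]
  have z : (ν + 1) * (bCoef (ν + 1) 0 * w ^ 0) - bCoef ν 0 * w ^ 0 = 0 := by
    rw [bCoef_zero_rec hν 0]; push_cast; ring
  rw [z, zero_add]
  refine tsum_congr fun m => ?_
  rw [bCoef_zero_rec hν (m+1)]
  have := bCoef_succ (ν + 1) m
  rw [show ν + 1 + 1 = ν + 2 by ring] at this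
  push_cast
  linear_combination (w ^ (m+1)) * this

/-- The function z times the derivative of the Bessel function at z. -/
noncomputable def bP (ν : ℝ) (z : ℝ) : ℝ :=
  ν * besselJ ν z - (z / 2) ^ ν * (z ^ 2 / 2) * bG (ν + 1) (z ^ 2 / 4)

theorem besselJ_eq (ν : ℝ) {z : ℝ} (hz : 0 < z) :
    besselJ ν z = (z / 2) ^ ν * bG ν (z ^ 2 / 4) := by
  unfold besselJ bG
  rw [← tsum_mul_left]
  refine tsum_congr fun m => ?_
  have h2 : (0:ℝ) < z / 2 := by positivity
  rw [Real.rpow_add h2, show (2 * (m:ℝ)) = ((2 * m : ℕ) : ℝ) by push_cast; ring, Real.rpow_natCast,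
    pow_mul, show (z/2)^2 = z^2/4 by ring]
  unfold bCoef
  ring

theorem bRpow_hasDerivAt (ν : ℝ) {z : ℝ} (hz : 0 < z) :
    HasDerivAt (fun z : ℝ => (z / 2) ^ ν) (ν * (z / 2) ^ ν / z) z := by
  have h2 : (0:ℝ) < z / 2 := by positivity
  have := ((hasDerivAt_id z).div_const 2).rpow_const (p := ν) (Or.inl h2.ne')
  refine this.congr_deriv ?_
  simp only [id]
  rw [Real.rpow_sub_one h2.ne']
  field_simp

theorem bG_comp {ν : ℝ} (hν : 0 ≤ ν) (z : ℝ) :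
    HasDerivAt (fun z : ℝ => bG ν (z ^ 2 / 4)) (- bG (ν + 1) (z ^ 2 / 4) * (z / 2)) z := by
  have h : HasDerivAt (fun z : ℝ => z ^ 2 / 4) (z / 2) z := by
    refine ((hasDerivAt_pow 2 z).div_const 4).congr_deriv ?_
    norm_num
    try ring
  exact (bG_hasDerivAt hν (z ^ 2 / 4)).comp z h

theorem besselJ_hasDerivAt {ν : ℝ} (hν : 0 ≤ ν) {z : ℝ} (hz : 0 < z) :
    HasDerivAt (besselJ ν) (bP ν z / z) z := by
  have h := (bRpow_hasDerivAt ν hz).mul (bG_comp hν z)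
  have e : besselJ ν =ᶠ[nhds z] (fun z : ℝ => (z / 2) ^ ν) * (fun z : ℝ => bG ν (z ^ 2 / 4)) := by
    filter_upwards [lt_mem_nhds hz] with y hy
    exact besselJ_eq ν hy
  refine (h.congr_of_eventuallyEq e).congr_deriv ?_
  unfold bP
  rw [besselJ_eq ν hz]
  field_simp
  ring

theorem bP_hasDerivAt {ν : ℝ} (hν : 0 ≤ ν) {z : ℝ} (hz : 0 < z) :
    HasDerivAt (bP ν) ((ν ^ 2 - z ^ 2) * besselJ ν z / z) z := by
  have hsq : HasDerivAt (fun z : ℝ => z ^ 2 / 2) z z := by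
    refine ((hasDerivAt_pow 2 z).div_const 2).congr_deriv ?_
    norm_num
    try ring
  have h := ((besselJ_hasDerivAt hν hz).const_mul ν).sub
    (((bRpow_hasDerivAt ν hz).mul hsq).mul (bG_comp (ν := ν + 1) (by linarith) z))
  refine HasDerivAt.congr_deriv (f := bP ν) h ?_
  have hr := bG_rec hν (z ^ 2 / 4)
  rw [show ν + 1 + 1 = ν + 2 by ring]
  unfold bP
  simp only [Pi.mul_apply]
  rw [besselJ_eq ν hz]
  field_simp
  linear_combination (4 * z ^ 2) * hr

/-- energy -/
noncomputable def bE (ν : ℝ) (z : ℝ) : ℝ :=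
  ((bP ν z + besselJ ν z / 2) ^ 2 + (z ^ 2 + (1 / 4 - ν ^ 2)) * besselJ ν z ^ 2) / z

theorem bE_hasDerivAt {ν : ℝ} (hν : 0 ≤ ν) {z : ℝ} (hz : 0 < z) :
    HasDerivAt (bE ν) (- (2 * (1 / 4 - ν ^ 2) * besselJ ν z ^ 2 / z ^ 2)) z := by
  have hJ := besselJ_hasDerivAt hν hz
  have hP := bP_hasDerivAt hν hz
  have h := ((((hP.add (hJ.div_const 2)).pow 2).add
    (((hasDerivAt_pow 2 z).add_const (1 / 4 - ν ^ 2)).mul (hJ.pow 2))).div (hasDerivAt_id z) hz.ne')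
  refine HasDerivAt.congr_deriv (f := bE ν) h ?_
  simp only [Pi.mul_apply, Pi.add_apply, Pi.pow_apply, id]
  field_simp
  push_cast
  ring

theorem bE_le {ν : ℝ} (hν : 0 ≤ ν) (hν2 : ν ≤ 1 / 2) {z : ℝ} (hz : 1 ≤ z) : bE ν z ≤ bE ν 1 := by
  have hanti : AntitoneOn (bE ν) (Set.Ici 1) := by
    refine antitoneOn_of_deriv_nonpos (convex_Ici 1) ?_ ?_ ?_
    · intro y hy
      exact (bE_hasDerivAt hν (lt_of_lt_of_le one_pos hy)).continuousAt.continuousWithinAt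
    · intro y hy
      rw [interior_Ici] at hy
      exact (bE_hasDerivAt hν (lt_trans one_pos hy)).differentiableAt.differentiableWithinAt
    · intro y hy
      rw [interior_Ici] at hy
      rw [(bE_hasDerivAt hν (lt_trans one_pos hy)).deriv]
      have : 0 ≤ 1 / 4 - ν ^ 2 := by nlinarith
      have : 0 ≤ 2 * (1 / 4 - ν ^ 2) * besselJ ν y ^ 2 / y ^ 2 := by positivity
      linarith
  exact hanti (Set.mem_Ici.2 le_rfl) (Set.mem_Ici.2 hz) hz

theorem bP_large {ν : ℝ} (hν : 0 ≤ ν) (hν2 : ν ≤ 1 / 2) {z : ℝ} (hz : 1 ≤ z) :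
    |bP ν z| ≤ 2 * √(bE ν 1) * √z := by
  have hz0 : 0 < z := by linarith
  have hE := bE_le hν hν2 hz
  have hmu : 0 ≤ 1 / 4 - ν ^ 2 := by nlinarith
  have hE2 : (bP ν z + besselJ ν z / 2) ^ 2 + (z ^ 2 + (1 / 4 - ν ^ 2)) * besselJ ν z ^ 2
      ≤ bE ν 1 * z := by
    rw [← div_le_iff₀ hz0]; exact hE
  have hJ2 : 0 ≤ (1 / 4 - ν ^ 2) * besselJ ν z ^ 2 := by positivity
  have hz2 : besselJ ν z ^ 2 ≤ z ^ 2 * besselJ ν z ^ 2 := by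
    have : 1 ≤ z ^ 2 := by nlinarith
    nlinarith [sq_nonneg (besselJ ν z)]
  have a1 : |bP ν z + besselJ ν z / 2| ≤ √(bE ν 1 * z) := by
    apply Real.abs_le_sqrt; nlinarith [sq_nonneg (besselJ ν z)]
  have a2 : |besselJ ν z| ≤ √(bE ν 1 * z) := by
    apply Real.abs_le_sqrt; nlinarith [sq_nonneg (bP ν z + besselJ ν z / 2)]
  rw [Real.sqrt_mul' _ hz0.le] at a1 a2
  rw [abs_le] at *
  constructor <;> linarith [a1.1, a1.2, a2.1, a2.2]

theorem bP_small {ν : ℝ} (hν : 0 ≤ ν) : ∃ K : ℝ, ∀ z : ℝ, 0 < z → z ≤ 1 → |bP ν z| ≤ K := by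
  have hc : ContinuousOn (fun z : ℝ => ν * ((z / 2) ^ ν * bG ν (z ^ 2 / 4))
      - (z / 2) ^ ν * (z ^ 2 / 2) * bG (ν + 1) (z ^ 2 / 4)) (Set.Icc 0 1) := by
    apply Continuous.continuousOn
    have c0 : Continuous (fun z : ℝ => bG ν (z ^ 2 / 4)) :=
      continuous_iff_continuousAt.2 fun z => (bG_comp hν z).continuousAt
    have c1 : Continuous (fun z : ℝ => bG (ν + 1) (z ^ 2 / 4)) :=
      continuous_iff_continuousAt.2 fun z => (bG_comp (by linarith) z).continuousAt
    have c2 : Continuous (fun z : ℝ => (z / 2) ^ ν) :=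
      (continuous_id.div_const 2).rpow_const (fun _ => Or.inr hν)
    fun_prop
  obtain ⟨K, hK⟩ := isCompact_Icc.exists_bound_of_continuousOn hc
  refine ⟨K, fun z h0 h1 => ?_⟩
  have := hK z ⟨h0.le, h1⟩
  rw [← besselJ_eq ν h0] at this
  exact this

theorem besselJ_deriv_bound {ν : ℝ} (hν : 0 ≤ ν) (hν2 : ν ≤ 1 / 2) :
    ∃ K > 0, ∀ z : ℝ, 0 < z → |bP ν z / z| ≤ K * (1 / z + 1 / √z) := by
  obtain ⟨K, hK⟩ := bP_small hν
  refine ⟨|K| + 2 * √(bE ν 1) + 1, by positivity, fun z hz => ?_⟩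
  have hs : 0 < √z := Real.sqrt_pos.2 hz
  have hE : 0 ≤ √(bE ν 1) := Real.sqrt_nonneg _
  rw [abs_div, abs_of_pos hz, div_le_iff₀ hz]
  have e : (|K| + 2 * √(bE ν 1) + 1) * (1 / z + 1 / √z) * z
      = (|K| + 2 * √(bE ν 1) + 1) * (1 + √z) := by
    have : z = √z * √z := (Real.mul_self_sqrt hz.le).symm
    rw [mul_assoc, add_mul (1 / z), one_div_mul_cancel hz.ne', one_div_mul_eq_div, Real.div_sqrt]
  rw [e]
  have hKa := abs_nonneg K
  rcases le_total z 1 with h | h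
  · have := (hK z hz h).trans (le_abs_self K)
    nlinarith [mul_nonneg hKa hs.le, mul_nonneg hE hs.le]
  · have := bP_large hν hν2 h
    nlinarith [mul_nonneg hKa hs.le, mul_nonneg hE hs.le]

theorem besselJ_diff {ν : ℝ} (hν : 0 ≤ ν) (hν2 : ν ≤ 1 / 2) :
    ∃ K > 0, ∀ s t y : ℝ, 1 ≤ t → t ≤ s → 0 < y → y ≤ 1 →
      |besselJ ν (s * y) - besselJ ν (t * y)| ≤ K * (s - t) / √t := by
  obtain ⟨K, hK0, hK⟩ := besselJ_deriv_bound hν hν2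
  refine ⟨2 * K, by positivity, fun s t y ht hs hy hy1 => ?_⟩
  have ht0 : 0 < t := by linarith
  have hty : 0 < t * y := by positivity
  have hsy : t * y ≤ s * y := by gcongr
  have hst : 0 < √t := Real.sqrt_pos.2 ht0
  have hsyq : 0 < √y := Real.sqrt_pos.2 hy
  have hm := (convex_Icc (t * y) (s * y)).norm_image_sub_le_of_norm_hasDerivWithin_le
    (f := besselJ ν) (f' := fun z => bP ν z / z) (C := K * (1 / (t * y) + 1 / √(t * y)))
    (fun z hz => (besselJ_hasDerivAt hν (lt_of_lt_of_le hty hz.1)).hasDerivWithinAt)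
    (fun z hz => by
      have hz0 := lt_of_lt_of_le hty hz.1
      refine (hK z hz0).trans ?_
      have := hz.1
      have : 0 < √(t * y) := Real.sqrt_pos.2 hty
      gcongr)
    (Set.left_mem_Icc.2 hsy) (Set.right_mem_Icc.2 hsy)
  rw [Real.norm_eq_abs, Real.norm_eq_abs, show s * y - t * y = (s - t) * y by ring, abs_mul,
    abs_of_nonneg (sub_nonneg.2 hs), abs_of_pos hy] at hm
  refine hm.trans ?_
  have h1 : (1 / (t * y) + 1 / √(t * y)) * y ≤ 2 / √t := by
    have a : 1 / (t * y) * y ≤ 1 / √t := by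
      rw [show 1 / (t * y) * y = 1 / t by field_simp]
      apply one_div_le_one_div_of_le hst
      exact (Real.sqrt_le_left ht0.le).2 (by nlinarith)
    have b : 1 / √(t * y) * y ≤ 1 / √t := by
      rw [Real.sqrt_mul ht0.le, div_mul_eq_mul_div, div_le_div_iff₀ (by positivity) hst]
      have : y ≤ √y := Real.le_sqrt_of_sq_le (by nlinarith)
      nlinarith
    rw [add_mul]
    have : 2 / √t = 1 / √t + 1 / √t := by ring
    linarith
  have hst' : 0 ≤ K * (s - t) := mul_nonneg hK0.le (sub_nonneg.2 hs)
  calc _ = K * (s - t) * ((1 / (t * y) + 1 / √(t * y)) * y) := by ring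
    _ ≤ K * (s - t) * (2 / √t) := by gcongr
    _ = _ := by ring

set_option maxHeartbeats 1000000

/-- There exists `C > 0` such that for all `n ≥ 1` with `λ_n > λ`,
`∫₀¹ (φ_n - ξ̃_n)² dx ≤ C/n²`; consequently `∑_{n : λ_n > λ} ‖φ_n - ξ̃_n‖²_{L²} < ∞`,
i.e. `{ξ̃_n}` is quadratically close to `{φ_n}` in `L²(0,1)`. -/
theorem stmt_17 (α ν κ : ℝ) (hα : α ∈ Set.Ioo (0:ℝ) 1)
    (hν : ν = (1 - α) / (2 - α)) (hκ : κ = (2 - α) / 2)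
    (j : ℕ → ℝ)
    (hjpos : ∀ n, 1 ≤ n → 0 < j n)
    (hjmono : ∀ m n, 1 ≤ m → m < n → j m < j n)
    (hjzero : ∀ n, 1 ≤ n → besselJ ν (j n) = 0)
    (hjtop : Filter.Tendsto j Filter.atTop Filter.atTop)
    (hasym : ∃ C : ℝ, ∀ n : ℕ, 1 ≤ n →
      |j n - Real.pi * ((n : ℝ) + ν / 2 - 1 / 4)| ≤ C / (n : ℝ))
    (hder : ∃ c₁ > (0:ℝ), ∃ c₂ > (0:ℝ), ∀ n, 1 ≤ n →
      c₁ / Real.sqrt (j n) ≤ |deriv (besselJ ν) (j n)| ∧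
      |deriv (besselJ ν) (j n)| ≤ c₂ / Real.sqrt (j n))
    (ev : ℕ → ℝ) (hev : ∀ n, ev n = (κ * j n) ^ 2)
    (lam : ℝ) (hlam : 0 < lam)
    (hnr1 : ∀ n, 1 ≤ n → lam ≠ ev n)
    (hnr2 : ∀ n k, 1 ≤ n → 1 ≤ k → lam - ev n ≠ ev k)
    (φ : ℕ → ℝ → ℝ)
    (hφ : ∀ n x, φ n x = Real.sqrt (2 * κ) * x ^ ((1 - α) / 2) *
      besselJ ν (j n * x ^ κ) / deriv (besselJ ν) (j n))
    (ξ : ℕ → ℝ → ℝ)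
    (hξ : ∀ n x, ξ n x = Real.sqrt (2 * κ) * x ^ ((1 - α) / 2) *
      besselJ ν ((Real.sqrt (ev n - lam) / κ) * x ^ κ) / deriv (besselJ ν) (j n)) :
    ∃ C > (0:ℝ),
      (∀ n, 1 ≤ n → lam < ev n →
        (∫ x in (0:ℝ)..1, (φ n x - ξ n x) ^ 2) ≤ C / (n : ℝ) ^ 2) ∧
      Summable (fun p : {n : ℕ // 1 ≤ n ∧ lam < ev n} =>
        ∫ x in (0:ℝ)..1, (φ p.1 x - ξ p.1 x) ^ 2) := by
  obtain ⟨hα0, hα1⟩ := hα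
  have hν0 : 0 ≤ ν := by rw [hν]; apply div_nonneg <;> linarith
  have hν2 : ν ≤ 1 / 2 := by
    rw [hν, div_le_div_iff₀ (by linarith) (by norm_num)]; linarith
  have hκ0 : 0 < κ := by rw [hκ]; linarith
  obtain ⟨K, hK0, hK⟩ := besselJ_diff hν0 hν2
  obtain ⟨A, hA⟩ := hasym
  obtain ⟨c₁, hc₁, c₂, hc₂, hd⟩ := hder
  set M : ℝ := lam / κ ^ 2 with hM
  have hM0 : 0 < M := by positivity
  obtain ⟨N, hN⟩ := exists_nat_ge (2 * M + 2 + |A|)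
  set B : ℝ := √(2 * κ) * (K * M * 2) / c₁ with hB
  have hB0 : 0 ≤ B := by positivity
  -- eventual bound
  have hmain : ∀ n : ℕ, 1 ≤ n → N ≤ n →
      (∫ x in (0:ℝ)..1, (φ n x - ξ n x) ^ 2) ≤ B ^ 2 / (n : ℝ) ^ 2 := by
    intro n hn hNn
    have hn1 : (1:ℝ) ≤ n := by exact_mod_cast hn
    have hnN : 2 * M + 2 + |A| ≤ (n:ℝ) := hN.trans (by exact_mod_cast hNn)
    have hA0 := abs_nonneg A
    have hjn : (n:ℝ) ≤ j n := by
      have h1 := (abs_le.1 (hA n hn)).1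
      have h2 : A / (n:ℝ) ≤ |A| := by
        rw [div_le_iff₀ (by linarith)]
        nlinarith [le_abs_self A]
      have h3 := Real.pi_gt_three
      have h4 : Real.pi * ((n : ℝ) - 1 / 4) ≤ Real.pi * ((n : ℝ) + ν / 2 - 1 / 4) := by
        gcongr; linarith
      have h5 : 3 * ((n : ℝ) - 1 / 4) ≤ Real.pi * ((n : ℝ) - 1 / 4) := by
        gcongr; linarith
      linarith
    set s := j n with hs
    have hs0 : 0 < s := by linarith
    set t := √(ev n - lam) / κ with ht
    have hs2 : 2 * M + 2 ≤ s := by linarith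
    have hev' : ev n - lam = κ ^ 2 * (s ^ 2 - M) := by
      rw [hev, ← hs, hM]; field_simp
    have hsM : s ^ 2 / 4 ≤ s ^ 2 - M := by nlinarith
    have hteq : t = √(s ^ 2 - M) := by
      rw [ht, hev', Real.sqrt_mul (by positivity), Real.sqrt_sq hκ0.le]
      field_simp
    have htsq : t ^ 2 = s ^ 2 - M := by
      rw [hteq, Real.sq_sqrt]; nlinarith [sq_nonneg s]
    have ht_half : s / 2 ≤ t := by
      rw [hteq]; apply Real.le_sqrt_of_sq_le; nlinarith
    have ht4 : s / 4 ≤ t := by linarith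
    have ht1 : 1 ≤ t := by linarith
    have ht0 : 0 < t := by linarith
    have hts : t ≤ s := by nlinarith
    have hdiff : s - t ≤ M / s := by
      rw [le_div_iff₀ hs0]; nlinarith
    have hss : 0 < √s := Real.sqrt_pos.2 hs0
    have hst : 0 < √t := Real.sqrt_pos.2 ht0
    have hsqrt : √s ≤ 2 * √t := by
      rw [Real.sqrt_le_left (by positivity), mul_pow, Real.sq_sqrt ht0.le]; linarith
    have hD := (hd n hn).1
    rw [← hs] at hD
    have hDpos : 0 < |deriv (besselJ ν) s| := lt_of_lt_of_le (by positivity) hD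
    have hpt : ∀ x : ℝ, 0 < x → x ≤ 1 → |φ n x - ξ n x| ≤ B / n := by
      intro x hx0 hx1
      have hy0 : 0 < x ^ κ := Real.rpow_pos_of_pos hx0 _
      have hy1 : x ^ κ ≤ 1 := Real.rpow_le_one hx0.le hx1 hκ0.le
      have hw0 : 0 ≤ x ^ ((1 - α) / 2) := Real.rpow_nonneg hx0.le _
      have hw1 : x ^ ((1 - α) / 2) ≤ 1 := Real.rpow_le_one hx0.le hx1 (by linarith)
      have hJ := hK s t (x ^ κ) ht1 hts hy0 hy1
      have e : φ n x - ξ n x = √(2 * κ) * x ^ ((1 - α) / 2) *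
          (besselJ ν (s * x ^ κ) - besselJ ν (t * x ^ κ)) / deriv (besselJ ν) s := by
        rw [hφ, hξ]; ring
      rw [e, abs_div, abs_mul, abs_mul, abs_of_nonneg (Real.sqrt_nonneg _), abs_of_nonneg hw0]
      have hJ2 : |besselJ ν (s * x ^ κ) - besselJ ν (t * x ^ κ)| ≤ K * (M / s) * 2 / √s := by
        refine hJ.trans ?_
        rw [div_le_div_iff₀ hst hss]
        have : K * (s - t) ≤ K * (M / s) := by gcongr
        have h0 : 0 ≤ K * (M / s) := by positivity
        calc K * (s - t) * √s ≤ K * (M / s) * (2 * √t) := by gcongr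
          _ = _ := by ring
      calc _ ≤ √(2 * κ) * 1 * (K * (M / s) * 2 / √s) / (c₁ / √s) := by gcongr
        _ = B / s := by rw [hB]; field_simp
        _ ≤ B / n := by gcongr
    have hint := intervalIntegral.norm_integral_le_of_norm_le_const (a := (0:ℝ)) (b := 1)
      (f := fun x => (φ n x - ξ n x) ^ 2) (C := (B / n) ^ 2) (by
        intro x hx
        rw [Set.uIoc_of_le zero_le_one] at hx
        rw [norm_pow, Real.norm_eq_abs]
        have := hpt x hx.1 hx.2
        gcongr)
    rw [Real.norm_eq_abs, sub_zero, abs_one, mul_one, div_pow] at hint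
    exact (le_abs_self _).trans hint
  set S : ℝ := ∑ n ∈ Finset.range N, |∫ x in (0:ℝ)..1, (φ n x - ξ n x) ^ 2| * (n:ℝ) ^ 2 with hS
  have hS0 : 0 ≤ S := Finset.sum_nonneg fun n _ => by positivity
  have hall : ∀ n : ℕ, 1 ≤ n →
      (∫ x in (0:ℝ)..1, (φ n x - ξ n x) ^ 2) ≤ (B ^ 2 + S + 1) / (n : ℝ) ^ 2 := by
    intro n hn
    have hn1 : (0:ℝ) < n := by exact_mod_cast hn
    rcases le_or_gt N n with h | h
    · refine (hmain n hn h).trans ?_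
      gcongr; linarith
    · rw [le_div_iff₀ (by positivity)]
      have h1 : |∫ x in (0:ℝ)..1, (φ n x - ξ n x) ^ 2| * (n:ℝ) ^ 2 ≤ S :=
        Finset.single_le_sum (f := fun n : ℕ => |∫ x in (0:ℝ)..1, (φ n x - ξ n x) ^ 2| * (n:ℝ) ^ 2)
          (fun i _ => by positivity) (Finset.mem_range.2 h)
      have h2 : (∫ x in (0:ℝ)..1, (φ n x - ξ n x) ^ 2) * (n:ℝ) ^ 2 ≤
          |∫ x in (0:ℝ)..1, (φ n x - ξ n x) ^ 2| * (n:ℝ) ^ 2 := by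
        gcongr; exact le_abs_self _
      have h3 := sq_nonneg B
      linarith
  refine ⟨B ^ 2 + S + 1, by positivity, fun n hn _ => hall n hn, ?_⟩
  have hsum : Summable (fun n : ℕ => (B ^ 2 + S + 1) / (n : ℝ) ^ 2) := by
    simpa [div_eq_mul_inv] using
      (Real.summable_nat_pow_inv.2 (by norm_num : 1 < 2)).mul_left (B ^ 2 + S + 1)
  refine Summable.of_nonneg_of_le (fun p => ?_) (fun p => hall p.1 p.2.1)
    (hsum.comp_injective Subtype.val_injective)
  exact intervalIntegral.integral_nonneg zero_le_one fun x _ => sq_nonneg _
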